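/- Let P be the explicit irreversible transition matrix defined from θ. Then: (i) for every θ-mean-zero f ∈ ℝⁿ with ‖f‖_θ = 1 and every g with (I − P)g = f, the asymptotic variance satisfies ν(f, P) = 2⟨g, f⟩_θ − 1 = (θ_n − θ_1)/(θ_n + θ_1); and (ii) for every irreducible row-stochastic matrix Q ∈ ℝ^{n×n} with invariant distribution θ, there exist a θ-mean-zero f with ‖f‖_θ = 1 and g with (I − Q)g = f such that ν(f, Q) ≥ (θ_n − θ_1)/(θ_n + θ_1). Hence the infimum over all irreducible row-stochastic matrices with invariant distribution θ of the worst-case asymptotic variance sup_f ν(f, ·) equals (θ_n − θ_1)/(θ_n + θ_1), and P attains it. -/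

import Mathlib

/-- Off-last-column entries of the explicit irreversible transition matrix built from a
positive nondecreasing vector `θ` on states `1, …, n` (empty products are `1`). -/
noncomputable def explicitAux (n : ℕ) (θ : ℕ → ℝ) (i j : ℕ) : ℝ :=
  if i = n then
    (θ j * (θ 1 + θ n)) / (θ n * (θ j + θ n)) *
      ∏ k ∈ Finset.Icc 1 (j - 1), (θ n - θ k) / (θ k + θ n)
  else if j < i then 0
  else if j = i then (θ i - θ 1) / (θ i + θ n)
  else (2 * θ j * (θ 1 + θ n)) / ((θ i + θ n) * (θ j + θ n)) *
      ∏ k ∈ Finset.Icc (i + 1) (j - 1), (θ n - θ k) / (θ k + θ n)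

/-- The explicit irreversible transition matrix: the last column is
`P_{in} = 1 − ∑_{k=1}^{n−1} P_{ik}` and the other entries are `explicitAux`. -/
noncomputable def explicitP (n : ℕ) (θ : ℕ → ℝ) (i j : ℕ) : ℝ :=
  if j = n then 1 - ∑ k ∈ Finset.Icc 1 (n - 1), explicitAux n θ i k
  else explicitAux n θ i j

/-- `m`-th power of a matrix indexed by the states `1, …, n`. -/
noncomputable def matPowIcc (n : ℕ) (P : ℕ → ℕ → ℝ) : ℕ → ℕ → ℕ → ℝ
  | 0, i, j => if i = j then 1 else 0
  | m + 1, i, j => ∑ k ∈ Finset.Icc 1 n, matPowIcc n P m i k * P k j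

open Finset in
noncomputable def xS (m : ℕ) (θ : ℕ → ℝ) (G : ℕ → ℝ) (i : ℕ) : ℝ :=
  ∑ j ∈ Finset.Icc (i + 1) m, (2 * θ j / (θ j + θ (m+1)) *
    ∏ k ∈ Finset.Icc (i + 1) (j - 1), (θ (m+1) - θ k) / (θ k + θ (m+1))) * G j

theorem xIcc_bot (a b : ℕ) (h : a ≤ b) : Finset.Icc a b = insert a (Finset.Icc (a+1) b) := by
  ext x; simp only [Finset.mem_Icc, Finset.mem_insert]; omega

theorem xsum_bot (a b : ℕ) (h : a ≤ b) (F : ℕ → ℝ) :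
    ∑ i ∈ Finset.Icc a b, F i = F a + ∑ i ∈ Finset.Icc (a+1) b, F i := by
  rw [xIcc_bot a b h, Finset.sum_insert (by simp)]

theorem xprod_bot (a b : ℕ) (h : a ≤ b) (F : ℕ → ℝ) :
    ∏ i ∈ Finset.Icc a b, F i = F a * ∏ i ∈ Finset.Icc (a+1) b, F i := by
  rw [xIcc_bot a b h, Finset.prod_insert (by simp)]

theorem xS_top (m : ℕ) (θ G : ℕ → ℝ) : xS m θ G m = 0 := by
  simp [xS]

theorem xS_rec (m : ℕ) (θ G : ℕ → ℝ) (i : ℕ) (h : i + 1 ≤ m) :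
    xS m θ G i = 2 * θ (i+1) / (θ (i+1) + θ (m+1)) * G (i+1) +
      (θ (m+1) - θ (i+1)) / (θ (i+1) + θ (m+1)) * xS m θ G (i+1) := by
  unfold xS
  rw [xsum_bot (i+1) m h, Finset.mul_sum]
  congr 1
  · simp
  · apply Finset.sum_congr rfl
    intro j hj
    rw [Finset.mem_Icc] at hj
    rw [xprod_bot (i+1) (j-1) (by omega)]
    ring

theorem xaux_last (m : ℕ) (θ G : ℕ → ℝ) :
    ∑ k ∈ Finset.Icc 1 m, explicitAux (m+1) θ (m+1) k * G k
      = (θ 1 + θ (m+1)) / (2 * θ (m+1)) * xS m θ G 0 := by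
  unfold xS
  rw [Finset.mul_sum]
  apply Finset.sum_congr (by simp)
  intro j hj
  simp only [explicitAux, if_true, zero_add]
  have : θ j * (θ 1 + θ (m + 1)) / (θ (m + 1) * (θ j + θ (m + 1))) =
    (θ 1 + θ (m+1)) / (2 * θ (m+1)) * (2 * θ j / (θ j + θ (m+1))) := by
    rw [div_mul_div_comm, ← mul_div_mul_left _ (θ (m + 1) * (θ j + θ (m + 1))) (two_ne_zero (α := ℝ))]
    congr 1 <;> ring
  rw [this]; ring

theorem xaux_lt (m : ℕ) (θ G : ℕ → ℝ) (i : ℕ) (h1 : 1 ≤ i) (h2 : i ≤ m) :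
    ∑ k ∈ Finset.Icc 1 m, explicitAux (m+1) θ i k * G k
      = (θ i - θ 1) / (θ i + θ (m+1)) * G i + (θ 1 + θ (m+1)) / (θ i + θ (m+1)) * xS m θ G i := by
  have hs : ∑ k ∈ Finset.Icc 1 m, explicitAux (m+1) θ i k * G k =
      ∑ k ∈ Finset.Icc i m, explicitAux (m+1) θ i k * G k := by
    symm
    apply Finset.sum_subset
    · intro x; simp only [Finset.mem_Icc]; omega
    · intro x hx hx'
      simp only [Finset.mem_Icc] at hx hx'
      have h3 : i ≠ m + 1 := by omega
      have h4 : x < i := by omega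
      simp [explicitAux, h3, h4]
  rw [hs, xsum_bot i m h2]
  congr 1
  · have h3 : i ≠ m + 1 := by omega
    simp [explicitAux, h3]
  · unfold xS
    rw [Finset.mul_sum]
    apply Finset.sum_congr rfl
    intro j hj
    rw [Finset.mem_Icc] at hj
    have h3 : i ≠ m + 1 := by omega
    have h4 : ¬ j < i := by omega
    have h5 : j ≠ i := by omega
    simp only [explicitAux, h3, h4, h5, if_false]
    have : 2 * θ j * (θ 1 + θ (m + 1)) / ((θ i + θ (m + 1)) * (θ j + θ (m + 1))) =
      (θ 1 + θ (m+1)) / (θ i + θ (m+1)) * (2 * θ j / (θ j + θ (m+1))) := by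
      rw [div_mul_div_comm]
      congr 1; ring
    rw [this]; ring

theorem xP_apply (m : ℕ) (θ g : ℕ → ℝ) (i : ℕ) :
    ∑ j ∈ Finset.Icc 1 (m+1), explicitP (m+1) θ i j * g j =
      g (m+1) + ∑ k ∈ Finset.Icc 1 m, explicitAux (m+1) θ i k * (g k - g (m+1)) := by
  rw [Finset.sum_Icc_succ_top (by omega)]
  have : ∑ j ∈ Finset.Icc 1 m, explicitP (m+1) θ i j * g j =
      ∑ j ∈ Finset.Icc 1 m, explicitAux (m+1) θ i j * g j := by
    apply Finset.sum_congr rfl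
    intro j hj
    rw [Finset.mem_Icc] at hj
    have : j ≠ m + 1 := by omega
    simp [explicitP, this]
  rw [this]
  simp only [explicitP, if_true, Nat.add_sub_cancel, mul_sub, Finset.sum_sub_distrib, ← Finset.sum_mul]
  ring

theorem xtele (F : ℕ → ℝ) (m : ℕ) : ∑ i ∈ Finset.Icc 1 m, (F (i-1) - F i) = F 0 - F m := by
  induction m with
  | zero => simp
  | succ k ih => rw [Finset.sum_Icc_succ_top (by omega), ih]; simp

/-- basic facts on f = (I-P) g -/
theorem xfacts (m : ℕ) (θ : ℕ → ℝ)
    (hpos : ∀ i, 1 ≤ i → i ≤ m+1 → 0 < θ i) (f g : ℕ → ℝ)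
    (hfg : ∀ i, 1 ≤ i → i ≤ m+1 →
        g i - ∑ j ∈ Finset.Icc 1 (m+1), explicitP (m+1) θ i j * g j = f i) :
    (∑ i ∈ Finset.Icc 1 (m+1), f i * θ i) = 0 ∧
    (∑ i ∈ Finset.Icc 1 (m+1), g i * f i * θ i) =
      θ (m+1) / (θ (m+1) + θ 1) * ∑ i ∈ Finset.Icc 1 (m+1), f i * f i * θ i := by
  have hn := hpos (m+1) (by omega) le_rfl
  have h1 := hpos 1 le_rfl (by omega)
  set a := θ 1 + θ (m+1) with ha
  have hapos : 0 < a := by positivity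
  set G : ℕ → ℝ := fun k => g k - g (m+1) with hG
  set S := xS m θ G with hS
  have e1 : ∀ i ∈ Finset.Icc 1 m, f i * θ i = a / 2 * (S (i-1) - S i) ∧
      f i * (θ i + θ (m+1)) = a * (G i - S i) := by
    intro i hi
    rw [Finset.mem_Icc] at hi
    have hi' := hpos i hi.1 (by omega)
    have h := hfg i hi.1 (by omega)
    rw [xP_apply] at h
    have h2 := xaux_lt m θ G i hi.1 hi.2
    have h3 := xS_rec m θ G (i-1) (by omega)
    have h4 : i - 1 + 1 = i := by omega
    rw [h4] at h3
    simp only [hG] at h2 h3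
    rw [h2] at h
    simp only [← hG] at h h3
    rw [← hS] at h h3
    have hfi : f i * (θ i + θ (m+1)) = a * (G i - S i) := by
      rw [← h]; simp only [hG]
      field_simp
      rw [ha]; ring
    refine ⟨?_, hfi⟩
    have hfi2 : f i = a * (G i - S i) / (θ i + θ (m+1)) := by
      rw [← hfi]; field_simp
    rw [hfi2, h3]
    field_simp
    ring
  have e2 : f (m+1) * θ (m+1) = - (a / 2) * S 0 := by
    have h := hfg (m+1) (by omega) le_rfl
    rw [xP_apply] at h
    have h2 := xaux_last m θ G
    simp only [hG] at h2
    rw [h2] at h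
    simp only [← hG] at h
    rw [← hS, ← ha] at h
    rw [← h]
    field_simp
    ring
  have e3 : S m = 0 := xS_top m θ G
  have hmean : (∑ i ∈ Finset.Icc 1 (m+1), f i * θ i) = 0 := by
    rw [Finset.sum_Icc_succ_top (by omega), e2, Finset.sum_congr rfl (fun i hi => (e1 i hi).1),
      ← Finset.mul_sum, xtele, e3]
    ring
  refine ⟨hmean, ?_⟩
  have e4 : ∑ i ∈ Finset.Icc 1 (m+1), g i * f i * θ i = ∑ i ∈ Finset.Icc 1 m, G i * f i * θ i := by
    have : ∑ i ∈ Finset.Icc 1 (m+1), g i * f i * θ i =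
       ∑ i ∈ Finset.Icc 1 (m+1), G i * f i * θ i + g (m+1) * ∑ i ∈ Finset.Icc 1 (m+1), f i * θ i := by
      rw [Finset.mul_sum, ← Finset.sum_add_distrib]
      apply Finset.sum_congr rfl
      intro i _
      simp only [hG]; ring
    rw [this, hmean, Finset.sum_Icc_succ_top (by omega)]
    simp [hG]
  have e5 : ∀ i ∈ Finset.Icc 1 m, G i * f i * θ i =
      θ (m+1) / a * (f i * f i * θ i) + (a/4) * (S (i-1)^2 - S i^2) := by
    intro i hi
    obtain ⟨h1, h2⟩ := e1 i hi
    have h3 : G i = S i + f i * (θ i + θ (m+1)) / a := by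
      rw [h2]; field_simp; ring
    have h4 : S (i-1) = S i + 2 * (f i * θ i) / a := by
      rw [h1]; field_simp; ring
    rw [h3, h4]
    field_simp
    ring
  rw [e4, Finset.sum_congr rfl e5, Finset.sum_add_distrib, ← Finset.mul_sum, ← Finset.mul_sum,
    xtele (fun i => S i ^ 2) m, Finset.sum_Icc_succ_top (by omega), e3]
  have e6 : f (m+1) = - (a / 2) * S 0 / θ (m+1) := by
    rw [← e2]; field_simp
  rw [e6, add_comm (θ (m+1)) (θ 1), ← ha]
  field_simp
  ring

theorem xS_one (m : ℕ) (θ : ℕ → ℝ)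
    (hpos : ∀ i, 1 ≤ i → i ≤ m+1 → 0 < θ i)
    (hmono : ∀ i j, 1 ≤ i → i ≤ j → j ≤ m+1 → θ i ≤ θ j) :
    ∀ d i, i + d = m → 0 ≤ xS m θ (fun _ => 1) i ∧ xS m θ (fun _ => 1) i ≤ 1 := by
  intro d
  induction d with
  | zero => intro i hi; obtain rfl : i = m := by omega
            rw [xS_top]; norm_num
  | succ d ih =>
    intro i hi
    obtain ⟨h1, h2⟩ := ih (i+1) (by omega)
    rw [xS_rec m θ _ i (by omega)]
    have p1 := hpos (i+1) (by omega) (by omega)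
    have p2 := hpos (m+1) (by omega) (by omega)
    have p3 := hmono (i+1) (m+1) (by omega) (by omega) le_rfl
    have q1 : 0 ≤ 2 * θ (i+1) / (θ (i+1) + θ (m+1)) := by positivity
    have q2 : 0 ≤ (θ (m+1) - θ (i+1)) / (θ (i+1) + θ (m+1)) :=
      div_nonneg (by linarith) (by positivity)
    have q3 : 2 * θ (i+1) / (θ (i+1) + θ (m+1)) + (θ (m+1) - θ (i+1)) / (θ (i+1) + θ (m+1)) = 1 := by
      field_simp; ring
    constructor
    · have := mul_nonneg q2 h1
      linarith
    · have := mul_le_mul_of_nonneg_left h2 q2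
      linarith

theorem xaux_nonneg (m : ℕ) (θ : ℕ → ℝ)
    (hpos : ∀ i, 1 ≤ i → i ≤ m+1 → 0 < θ i)
    (hmono : ∀ i j, 1 ≤ i → i ≤ j → j ≤ m+1 → θ i ≤ θ j)
    (i j : ℕ) (hi : 1 ≤ i) (hi' : i ≤ m+1) (hj : 1 ≤ j) (hj' : j ≤ m) :
    0 ≤ explicitAux (m+1) θ i j := by
  have p1 := hpos i hi hi'
  have p2 := hpos j hj (by omega)
  have p3 := hpos 1 (by omega) (by omega)
  have p4 := hpos (m+1) (by omega) (by omega)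
  have pr : ∀ s : ℕ, 1 ≤ s → 0 ≤ ∏ k ∈ Finset.Icc s (j - 1), (θ (m+1) - θ k) / (θ k + θ (m+1)) := by
    intro s hs
    apply Finset.prod_nonneg
    intro k hk
    rw [Finset.mem_Icc] at hk
    have := hpos k (by omega) (by omega)
    have := hmono k (m+1) (by omega) (by omega) le_rfl
    exact div_nonneg (by linarith) (by positivity)
  unfold explicitAux
  split_ifs
  · exact mul_nonneg (by positivity) (pr 1 le_rfl)
  · exact le_rfl
  · have := hmono 1 i le_rfl hi hi'
    exact div_nonneg (by linarith) (by positivity)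
  · exact mul_nonneg (by positivity) (pr (i+1) (by omega))

theorem xP_nonneg (m : ℕ) (θ : ℕ → ℝ)
    (hpos : ∀ i, 1 ≤ i → i ≤ m+1 → 0 < θ i)
    (hmono : ∀ i j, 1 ≤ i → i ≤ j → j ≤ m+1 → θ i ≤ θ j)
    (i j : ℕ) (hi : 1 ≤ i) (hi' : i ≤ m+1) (hj : 1 ≤ j) (hj' : j ≤ m+1) :
    0 ≤ explicitP (m+1) θ i j := by
  have p1 := hpos i hi hi'
  have p3 := hpos 1 (by omega) (by omega)
  have p4 := hpos (m+1) (by omega) (by omega)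
  unfold explicitP
  split_ifs with h
  · rw [Nat.add_sub_cancel]
    by_cases him : i = m+1
    · have := xaux_last m θ (fun _ => 1)
      simp only [mul_one] at this
      rw [him, this]
      obtain ⟨h1, h2⟩ := xS_one m θ hpos hmono m 0 (by omega)
      have h3 := hmono 1 (m+1) le_rfl (by omega) le_rfl
      have h4 : (θ 1 + θ (m+1)) / (2 * θ (m+1)) ≤ 1 := by
        rw [div_le_one (by positivity)]; linarith
      have := mul_le_one₀ h4 h1 h2
      linarith
    · have := xaux_lt m θ (fun _ => 1) i hi (by omega)
      simp only [mul_one] at this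
      rw [this]
      obtain ⟨h1, h2⟩ := xS_one m θ hpos hmono (m-i) i (by omega)
      have h5 : 0 ≤ (θ 1 + θ (m+1)) / (θ i + θ (m+1)) := by positivity
      have h6 : (θ i - θ 1) / (θ i + θ (m+1)) + (θ 1 + θ (m+1)) / (θ i + θ (m+1)) = 1 := by
        field_simp; ring
      have := mul_le_mul_of_nonneg_left h2 h5
      linarith
  · exact xaux_nonneg m θ hpos hmono i j hi hi' hj (by omega)

theorem xP_row (m : ℕ) (θ : ℕ → ℝ) (i : ℕ) :
    ∑ j ∈ Finset.Icc 1 (m+1), explicitP (m+1) θ i j = 1 := by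
  have := xP_apply m θ (fun _ => 1) i
  simpa using this

theorem xP_inv (m : ℕ) (θ : ℕ → ℝ)
    (hpos : ∀ i, 1 ≤ i → i ≤ m+1 → 0 < θ i) (j : ℕ) (hj : 1 ≤ j) (hj' : j ≤ m+1) :
    ∑ i ∈ Finset.Icc 1 (m+1), θ i * explicitP (m+1) θ i j = θ j := by
  have h := (xfacts m θ hpos _ (fun k => if k = j then 1 else 0) (fun i _ _ => rfl)).1
  have hmem : j ∈ Finset.Icc 1 (m+1) := Finset.mem_Icc.2 ⟨hj, hj'⟩
  simp only [mul_ite, mul_one, mul_zero, sub_mul, ite_mul, one_mul, zero_mul,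
    Finset.sum_sub_distrib, Finset.sum_ite_eq', hmem, if_true] at h
  simp only [mul_comm (θ _)]
  linarith

theorem xP_step (m : ℕ) (θ : ℕ → ℝ)
    (hpos : ∀ i, 1 ≤ i → i ≤ m+1 → 0 < θ i) (i : ℕ) (hi : 1 ≤ i) (hi' : i ≤ m) :
    0 < explicitP (m+1) θ i (i+1) := by
  have p1 := hpos i hi (by omega)
  have p2 := hpos (i+1) (by omega) (by omega)
  have p3 := hpos 1 (by omega) (by omega)
  have p4 := hpos (m+1) (by omega) (by omega)
  unfold explicitP
  split_ifs with h
  · obtain rfl : i = m := by omega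
    have := xaux_lt i θ (fun _ => 1) i hi le_rfl
    simp only [mul_one, xS_top, mul_zero, add_zero] at this
    rw [Nat.add_sub_cancel, this, sub_pos, div_lt_one (by positivity)]
    linarith
  · have h3 : i ≠ m + 1 := by omega
    simp only [explicitAux, h3, if_false]
    simp
    positivity

theorem xP_back (m : ℕ) (hm : 1 ≤ m) (θ : ℕ → ℝ)
    (hpos : ∀ i, 1 ≤ i → i ≤ m+1 → 0 < θ i) :
    0 < explicitP (m+1) θ (m+1) 1 := by
  have p3 := hpos 1 (by omega) (by omega)
  have p4 := hpos (m+1) (by omega) (by omega)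
  have : 1 ≠ m + 1 := by omega
  simp only [explicitP, explicitAux, this, if_false, if_true]
  simp
  positivity

theorem xpow_nonneg (n : ℕ) (Q : ℕ → ℕ → ℝ)
    (hQ : ∀ i j, 1 ≤ i → i ≤ n → 1 ≤ j → j ≤ n → 0 ≤ Q i j) (i : ℕ) :
    ∀ m j, 1 ≤ j → j ≤ n → 0 ≤ matPowIcc n Q m i j := by
  intro m
  induction m with
  | zero => intro j _ _; simp only [matPowIcc]; split_ifs <;> norm_num
  | succ m ih =>
    intro j h1 h2
    simp only [matPowIcc]
    apply Finset.sum_nonneg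
    intro k hk
    rw [Finset.mem_Icc] at hk
    exact mul_nonneg (ih k hk.1 hk.2) (hQ k j hk.1 hk.2 h1 h2)

theorem xpow_step (n : ℕ) (Q : ℕ → ℕ → ℝ)
    (hQ : ∀ i j, 1 ≤ i → i ≤ n → 1 ≤ j → j ≤ n → 0 ≤ Q i j) (i k j m : ℕ)
    (hk : 1 ≤ k) (hk' : k ≤ n) (hj : 1 ≤ j) (hj' : j ≤ n)
    (h : 0 < matPowIcc n Q m i k) (h' : 0 < Q k j) : 0 < matPowIcc n Q (m+1) i j := by
  simp only [matPowIcc]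
  apply Finset.sum_pos'
  · intro l hl
    rw [Finset.mem_Icc] at hl
    exact mul_nonneg (xpow_nonneg n Q hQ i m l hl.1 hl.2) (hQ l j hl.1 hl.2 hj hj')
  · exact ⟨k, Finset.mem_Icc.2 ⟨hk, hk'⟩, mul_pos h h'⟩

theorem xP_irred (m : ℕ) (hm : 1 ≤ m) (θ : ℕ → ℝ)
    (hpos : ∀ i, 1 ≤ i → i ≤ m+1 → 0 < θ i)
    (hmono : ∀ i j, 1 ≤ i → i ≤ j → j ≤ m+1 → θ i ≤ θ j)
    (i j : ℕ) (hi : 1 ≤ i) (hi' : i ≤ m+1) (hj : 1 ≤ j) (hj' : j ≤ m+1) :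
    ∃ t : ℕ, 1 ≤ t ∧ 0 < matPowIcc (m+1) (explicitP (m+1) θ) t i j := by
  have hQ := xP_nonneg m θ hpos hmono
  have up : ∀ d k, 1 ≤ k → k + d ≤ m + 1 → (∃ t, 0 < matPowIcc (m+1) (explicitP (m+1) θ) t i k) →
      ∃ t, 0 < matPowIcc (m+1) (explicitP (m+1) θ) t i (k+d) := by
    intro d
    induction d with
    | zero => intro k _ _ h; exact h
    | succ d ih =>
      intro k h1 h2 h
      obtain ⟨t, ht⟩ := ih k h1 (by omega) h
      exact ⟨t+1, xpow_step _ _ hQ i (k+d) (k+d+1) t (by omega) (by omega) (by omega) (by omega) ht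
        (xP_step m θ hpos (k+d) (by omega) (by omega))⟩
  have h0 : ∃ t, 0 < matPowIcc (m+1) (explicitP (m+1) θ) t i i := ⟨0, by simp [matPowIcc]⟩
  obtain ⟨t, ht⟩ := up (m+1-i) i hi (by omega) h0
  rw [show i + (m+1-i) = m+1 by omega] at ht
  have ht1 := xpow_step _ _ hQ i (m+1) 1 t (by omega) (by omega) (by omega) (by omega) ht
    (xP_back m hm θ hpos)
  have up2 : ∀ d, 1 + d ≤ m + 1 → ∃ t, 1 ≤ t ∧ 0 < matPowIcc (m+1) (explicitP (m+1) θ) t i (1+d) := by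
    intro d
    induction d with
    | zero => intro _; exact ⟨t+1, by omega, ht1⟩
    | succ d ih =>
      intro h2
      obtain ⟨t, _, ht⟩ := ih (by omega)
      exact ⟨t+1, by omega, xpow_step _ _ hQ i (1+d) (1+d+1) t (by omega) (by omega) (by omega) (by omega) ht
        (xP_step m θ hpos (1+d) (by omega) (by omega))⟩
  have := up2 (j-1) (by omega)
  rwa [show 1 + (j-1) = j by omega] at this

theorem xreach (n : ℕ) (Q : ℕ → ℕ → ℝ)
    (hQ : ∀ i j, 1 ≤ i → i ≤ n → 1 ≤ j → j ≤ n → 0 ≤ Q i j) (S : ℕ → Prop) (i : ℕ) (hi : S i)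
    (hS : ∀ k j, 1 ≤ k → k ≤ n → 1 ≤ j → j ≤ n → S k → 0 < Q k j → S j) :
    ∀ m j, 1 ≤ j → j ≤ n → 0 < matPowIcc n Q m i j → S j := by
  intro m
  induction m with
  | zero =>
    intro j _ _ h
    by_cases hij : i = j
    · exact hij ▸ hi
    · simp [matPowIcc, hij] at h
  | succ m ih =>
    intro j h1 h2 h
    simp only [matPowIcc] at h
    obtain ⟨k, hk, hk'⟩ := Finset.exists_lt_of_sum_lt (s := Finset.Icc 1 n) (f := fun _ => (0:ℝ))
      (g := fun k => matPowIcc n Q m i k * Q k j) (by simpa using h)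
    rw [Finset.mem_Icc] at hk
    have hq := hQ k j hk.1 hk.2 h1 h2
    have hq' : 0 < Q k j := by
      rcases hq.lt_or_eq with h | h
      · exact h
      · simp [← h] at hk'
    exact hS k j hk.1 hk.2 h1 h2 (ih k hk.1 hk.2 (pos_of_mul_pos_left hk' hq)) hq'

theorem xminp (n : ℕ) (hn : 1 ≤ n) (Q : ℕ → ℕ → ℝ)
    (hQ : ∀ i j, 1 ≤ i → i ≤ n → 1 ≤ j → j ≤ n → 0 ≤ Q i j)
    (hrow : ∀ i, 1 ≤ i → i ≤ n → ∑ j ∈ Finset.Icc 1 n, Q i j = 1)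
    (hirr : ∀ i j, 1 ≤ i → i ≤ n → 1 ≤ j → j ≤ n →
        ∃ m : ℕ, 1 ≤ m ∧ 0 < matPowIcc n Q m i j)
    (g : ℕ → ℝ) (hg : ∀ i, 1 ≤ i → i < n → 0 ≤ g i - ∑ j ∈ Finset.Icc 1 n, Q i j * g j) :
    ∀ i, 1 ≤ i → i ≤ n → g n ≤ g i := by
  obtain ⟨s, hs, hmin⟩ := Finset.exists_min_image (Finset.Icc 1 n) g ⟨1, by simp [hn]⟩
  have hs' := Finset.mem_Icc.1 hs
  have key : g n = g s ∨ g n = g s := by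
    obtain ⟨t, _, ht⟩ := hirr s n hs'.1 hs'.2 hn le_rfl
    refine xreach n Q hQ (fun k => g k = g s ∨ g n = g s) s (Or.inl rfl) ?_ t n hn le_rfl ht
    intro k j h1 h2 h3 h4 hk hkj
    rcases hk with hk | hk
    · by_cases hkn : k = n
      · right; rw [← hkn]; exact hk
      left
      have h5 := hg k h1 (by omega)
      have h6 : ∑ j ∈ Finset.Icc 1 n, Q k j * (g j - g s) ≤ 0 := by
        simp only [mul_sub, Finset.sum_sub_distrib, ← Finset.sum_mul, hrow k h1 h2]
        linarith
      have h7 : ∀ l ∈ Finset.Icc 1 n, 0 ≤ Q k l * (g l - g s) := by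
        intro l hl
        have hl' := Finset.mem_Icc.1 hl
        exact mul_nonneg (hQ k l h1 h2 hl'.1 hl'.2) (by linarith [hmin l hl])
      have h8 := Finset.single_le_sum h7 (Finset.mem_Icc.2 ⟨h3, h4⟩)
      have h9 := hmin j (Finset.mem_Icc.2 ⟨h3, h4⟩)
      by_contra hne
      have h10 : 0 < g j - g s := by
        rcases lt_or_eq_of_le h9 with h | h
        · linarith
        · exact absurd h.symm hne
      have := mul_pos hkj h10
      linarith
    · exact Or.inr hk
  intro i h1 h2
  have := hmin i (Finset.mem_Icc.2 ⟨h1, h2⟩)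
  rcases key with h | h <;> linarith

noncomputable def xT (n : ℕ) (θ : ℕ → ℝ) (Q : ℕ → ℕ → ℝ) :
    ((Finset.Icc 1 n) → ℝ) →ₗ[ℝ] ((Finset.Icc 1 n) → ℝ) where
  toFun g := fun i => g i - ∑ j : Finset.Icc 1 n, Q i j * g j + ∑ j : Finset.Icc 1 n, g j * θ j
  map_add' g h := by
    funext i
    simp only [Pi.add_apply, mul_add, add_mul, Finset.sum_add_distrib]; ring
  map_smul' c g := by
    funext i
    simp only [Pi.smul_apply, smul_eq_mul, RingHom.id_apply, mul_add, mul_sub, Finset.mul_sum]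
    congr 1
    · congr 1
      exact Finset.sum_congr rfl fun _ _ => by ring
    · exact Finset.sum_congr rfl fun _ _ => by ring

theorem xext (n : ℕ) (g : (Finset.Icc 1 n) → ℝ) : ∃ G : ℕ → ℝ, g = fun i : Finset.Icc 1 n => G i :=
  ⟨fun i => if h : i ∈ Finset.Icc 1 n then g ⟨i, h⟩ else 0, by funext i; simp⟩

theorem xT_apply (n : ℕ) (θ : ℕ → ℝ) (Q : ℕ → ℕ → ℝ) (G : ℕ → ℝ) (i : Finset.Icc 1 n) :
    xT n θ Q (fun i => G i) i = G i - ∑ j ∈ Finset.Icc 1 n, Q i j * G j +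
      ∑ j ∈ Finset.Icc 1 n, G j * θ j := by
  simp only [xT, LinearMap.coe_mk, AddHom.coe_mk]
  rw [Finset.sum_coe_sort (Finset.Icc 1 n) (fun j => Q i j * G j),
    Finset.sum_coe_sort (Finset.Icc 1 n) (fun j => G j * θ j)]

theorem xmean (n : ℕ) (θ : ℕ → ℝ) (Q : ℕ → ℕ → ℝ)
    (hinv : ∀ j, 1 ≤ j → j ≤ n → ∑ i ∈ Finset.Icc 1 n, θ i * Q i j = θ j) (G : ℕ → ℝ) :
    ∑ i ∈ Finset.Icc 1 n, (G i - ∑ j ∈ Finset.Icc 1 n, Q i j * G j) * θ i = 0 := by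
  simp only [sub_mul, Finset.sum_sub_distrib, Finset.sum_mul]
  rw [Finset.sum_comm, sub_eq_zero]
  apply Finset.sum_congr rfl
  intro j hj
  rw [Finset.mem_Icc] at hj
  rw [← hinv j hj.1 hj.2, Finset.mul_sum]
  exact Finset.sum_congr rfl fun _ _ => by ring

theorem xT_mean (n : ℕ) (θ : ℕ → ℝ) (Q : ℕ → ℕ → ℝ)
    (hsum : ∑ i ∈ Finset.Icc 1 n, θ i = 1)
    (hinv : ∀ j, 1 ≤ j → j ≤ n → ∑ i ∈ Finset.Icc 1 n, θ i * Q i j = θ j) (G F : ℕ → ℝ)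
    (h : xT n θ Q (fun i => G i) = fun i : Finset.Icc 1 n => F i) (hF : ∑ i ∈ Finset.Icc 1 n, F i * θ i = 0) :
    (∑ i ∈ Finset.Icc 1 n, G i * θ i = 0) ∧ ∀ i, 1 ≤ i → i ≤ n →
      G i - ∑ j ∈ Finset.Icc 1 n, Q i j * G j = F i := by
  have h1 : ∀ i ∈ Finset.Icc 1 n, G i - ∑ j ∈ Finset.Icc 1 n, Q i j * G j +
      ∑ j ∈ Finset.Icc 1 n, G j * θ j = F i := by
    intro i hi
    rw [← xT_apply n θ Q G ⟨i, hi⟩, h]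
  have h2 : ∑ i ∈ Finset.Icc 1 n, G i * θ i = 0 := by
    have h3 := xmean n θ Q hinv G
    rw [Finset.sum_congr rfl (fun i hi => by rw [← h1 i hi])] at hF
    simp only [add_mul, Finset.sum_add_distrib] at hF
    rw [h3, ← Finset.mul_sum, hsum] at hF
    linarith
  refine ⟨h2, fun i hi hi' => ?_⟩
  have := h1 i (Finset.mem_Icc.2 ⟨hi, hi'⟩)
  rw [h2] at this
  linarith

theorem xT_inj (n : ℕ) (hn : 1 ≤ n) (θ : ℕ → ℝ) (Q : ℕ → ℕ → ℝ)
    (hsum : ∑ i ∈ Finset.Icc 1 n, θ i = 1)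
    (hQ : ∀ i j, 1 ≤ i → i ≤ n → 1 ≤ j → j ≤ n → 0 ≤ Q i j)
    (hrow : ∀ i, 1 ≤ i → i ≤ n → ∑ j ∈ Finset.Icc 1 n, Q i j = 1)
    (hirr : ∀ i j, 1 ≤ i → i ≤ n → 1 ≤ j → j ≤ n →
        ∃ m : ℕ, 1 ≤ m ∧ 0 < matPowIcc n Q m i j)
    (hinv : ∀ j, 1 ≤ j → j ≤ n → ∑ i ∈ Finset.Icc 1 n, θ i * Q i j = θ j) :
    LinearMap.ker (xT n θ Q) = ⊥ := by
  rw [LinearMap.ker_eq_bot']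
  intro g hg
  obtain ⟨G, rfl⟩ := xext n g
  obtain ⟨h1, h2⟩ := xT_mean n θ Q hsum hinv G (fun _ => 0) hg (by simp)
  have h3 := xminp n hn Q hQ hrow hirr G (fun i hi hi' => (h2 i hi hi'.le).ge)
  have h4 := xminp n hn Q hQ hrow hirr (fun i => - G i) (fun i hi hi' => by
    have := h2 i hi hi'.le
    simp only [mul_neg, Finset.sum_neg_distrib]; linarith)
  have h5 : ∀ i ∈ Finset.Icc 1 n, G i = G n := by
    intro i hi
    rw [Finset.mem_Icc] at hi
    have := h3 i hi.1 hi.2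
    have := h4 i hi.1 hi.2
    linarith
  rw [Finset.sum_congr rfl (fun i hi => by rw [h5 i hi]), ← Finset.mul_sum, hsum] at h1
  funext i
  have := h5 i i.2
  simp only [Pi.zero_apply]
  linarith

theorem xpartii (n : ℕ) (hn : 2 ≤ n) (θ : ℕ → ℝ)
    (hpos : ∀ i, 1 ≤ i → i ≤ n → 0 < θ i)
    (hsum : ∑ i ∈ Finset.Icc 1 n, θ i = 1) (Q : ℕ → ℕ → ℝ)
    (hQ : ∀ i j, 1 ≤ i → i ≤ n → 1 ≤ j → j ≤ n → 0 ≤ Q i j)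
    (hrow : ∀ i, 1 ≤ i → i ≤ n → ∑ j ∈ Finset.Icc 1 n, Q i j = 1)
    (hirr : ∀ i j, 1 ≤ i → i ≤ n → 1 ≤ j → j ≤ n →
        ∃ m : ℕ, 1 ≤ m ∧ 0 < matPowIcc n Q m i j)
    (hinv : ∀ j, 1 ≤ j → j ≤ n → ∑ i ∈ Finset.Icc 1 n, θ i * Q i j = θ j) :
    ∃ f g : ℕ → ℝ,
        (∑ i ∈ Finset.Icc 1 n, f i * θ i) = 0 ∧
        (∑ i ∈ Finset.Icc 1 n, f i * f i * θ i) = 1 ∧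
        (∀ i, 1 ≤ i → i ≤ n →
          g i - ∑ j ∈ Finset.Icc 1 n, Q i j * g j = f i) ∧
        (θ n - θ 1) / (θ n + θ 1) ≤
          2 * (∑ i ∈ Finset.Icc 1 n, g i * f i * θ i) - 1 := by
  have p1 := hpos 1 le_rfl (by omega)
  have pn := hpos n (by omega) le_rfl
  have m1 : 1 ∈ Finset.Icc 1 n := Finset.mem_Icc.2 ⟨le_rfl, by omega⟩
  have mn : n ∈ Finset.Icc 1 n := Finset.mem_Icc.2 ⟨by omega, le_rfl⟩
  have hn1 : n ≠ 1 := by omega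
  set F : ℕ → ℝ := fun i => (if i = 1 then 1 / θ 1 else 0) - (if i = n then 1 / θ n else 0) with hF
  have sumF : ∀ H : ℕ → ℝ, ∑ i ∈ Finset.Icc 1 n, H i * F i * θ i = H 1 - H n := by
    intro H
    have : ∀ i ∈ Finset.Icc 1 n, H i * F i * θ i =
        (if i = 1 then H 1 else 0) - (if i = n then H n else 0) := by
      intro i _
      simp only [hF]
      split_ifs with a b b
      · omega
      · subst a; field_simp; ring
      · subst b; field_simp; ring
      · ring
    rw [Finset.sum_congr rfl this, Finset.sum_sub_distrib]
    simp only [Finset.sum_ite_eq', m1, mn, if_true]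
  have F0 : ∑ i ∈ Finset.Icc 1 n, F i * θ i = 0 := by
    have := sumF (fun _ => 1)
    simpa using this
  have F1 : F 1 = 1 / θ 1 := by simp [hF, hn1.symm]
  have Fn : F n = - (1 / θ n) := by simp [hF, hn1]
  have F2 : ∑ i ∈ Finset.Icc 1 n, F i * F i * θ i = 1 / θ 1 + 1 / θ n := by
    rw [sumF F, F1, Fn]; ring
  have inj := xT_inj n (by omega) θ Q hsum hQ hrow hirr hinv
  have surj := LinearMap.injective_iff_surjective.1 (LinearMap.ker_eq_bot.1 inj)
  obtain ⟨g, hg⟩ := surj (fun i => F i)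
  obtain ⟨G, rfl⟩ := xext n g
  obtain ⟨-, h2⟩ := xT_mean n θ Q hsum hinv G F hg F0
  have h3 := xminp n (by omega) Q hQ hrow hirr G (fun i hi hi' => by
    rw [h2 i hi hi'.le]
    have : i ≠ n := by omega
    simp only [hF, this, if_false, sub_zero]
    split_ifs <;> positivity)
  have h4 : G n + 1 / θ 1 ≤ G 1 := by
    have h5 := h2 1 le_rfl (by omega)
    rw [F1] at h5
    have h6 : ∑ j ∈ Finset.Icc 1 n, Q 1 j * G n ≤ ∑ j ∈ Finset.Icc 1 n, Q 1 j * G j := by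
      apply Finset.sum_le_sum
      intro j hj
      rw [Finset.mem_Icc] at hj
      exact mul_le_mul_of_nonneg_left (h3 j hj.1 hj.2) (hQ 1 j le_rfl (by omega) hj.1 hj.2)
    rw [← Finset.sum_mul, hrow 1 le_rfl (by omega)] at h6
    linarith
  set N := 1 / θ 1 + 1 / θ n with hN
  have Npos : 0 < N := by positivity
  set s := (Real.sqrt N)⁻¹ with hs
  have hs2 : s * s = N⁻¹ := by
    rw [hs, ← mul_inv, Real.mul_self_sqrt Npos.le]
  refine ⟨fun i => s * F i, fun i => s * G i, ?_, ?_, ?_, ?_⟩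
  · simp only [mul_assoc, ← Finset.mul_sum]
    rw [F0, mul_zero]
  · have : ∀ i ∈ Finset.Icc 1 n, s * F i * (s * F i) * θ i = (s * s) * (F i * F i * θ i) :=
      fun _ _ => by ring
    rw [Finset.sum_congr rfl this, ← Finset.mul_sum, F2, hs2, inv_mul_cancel₀ Npos.ne']
  · intro i hi hi'
    simp only
    rw [← h2 i hi hi', mul_sub, Finset.mul_sum]
    congr 1
    exact Finset.sum_congr rfl fun _ _ => by ring
  · have : ∀ i ∈ Finset.Icc 1 n, s * G i * (s * F i) * θ i = (s * s) * (G i * F i * θ i) :=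
      fun _ _ => by ring
    rw [Finset.sum_congr rfl this, ← Finset.mul_sum, sumF, hs2]
    have h7 : N⁻¹ * (1 / θ 1) ≤ N⁻¹ * (G 1 - G n) :=
      mul_le_mul_of_nonneg_left (by linarith) (by positivity)
    have h8 : (θ n - θ 1) / (θ n + θ 1) = 2 * (N⁻¹ * (1 / θ 1)) - 1 := by
      rw [hN]; field_simp; ring
    linarith

theorem xbdd (n : ℕ) (hn : 2 ≤ n) (θ : ℕ → ℝ)
    (hpos : ∀ i, 1 ≤ i → i ≤ n → 0 < θ i)
    (hmono : ∀ i j, 1 ≤ i → i ≤ j → j ≤ n → θ i ≤ θ j)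
    (hsum : ∑ i ∈ Finset.Icc 1 n, θ i = 1) (Q : ℕ → ℕ → ℝ)
    (hQ : ∀ i j, 1 ≤ i → i ≤ n → 1 ≤ j → j ≤ n → 0 ≤ Q i j)
    (hrow : ∀ i, 1 ≤ i → i ≤ n → ∑ j ∈ Finset.Icc 1 n, Q i j = 1)
    (hirr : ∀ i j, 1 ≤ i → i ≤ n → 1 ≤ j → j ≤ n →
        ∃ m : ℕ, 1 ≤ m ∧ 0 < matPowIcc n Q m i j)
    (hinv : ∀ j, 1 ≤ j → j ≤ n → ∑ i ∈ Finset.Icc 1 n, θ i * Q i j = θ j) :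
    BddAbove {w : ℝ | ∃ f g : ℕ → ℝ,
          (∑ i ∈ Finset.Icc 1 n, f i * θ i) = 0 ∧
          (∑ i ∈ Finset.Icc 1 n, f i * f i * θ i) = 1 ∧
          (∀ i, 1 ≤ i → i ≤ n →
            g i - ∑ j ∈ Finset.Icc 1 n, Q i j * g j = f i) ∧
          w = 2 * (∑ i ∈ Finset.Icc 1 n, g i * f i * θ i) - 1} := by
  have p1 := hpos 1 le_rfl (by omega)
  have inj := xT_inj n (by omega) θ Q hsum hQ hrow hirr hinv
  obtain ⟨K, -, hK⟩ := LinearMap.exists_antilipschitzWith _ inj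
  set B := 1 + 1 / θ 1 with hB
  have Bpos : 0 < B := by positivity
  refine ⟨2 * (K * B * B) - 1, ?_⟩
  rintro w ⟨f, g, hf0, hf1, hfg, rfl⟩
  have hfB : ∀ i ∈ Finset.Icc 1 n, |f i| ≤ B := by
    intro i hi
    have hi' := Finset.mem_Icc.1 hi
    have h1 : f i * f i * θ i ≤ 1 := by
      rw [← hf1]
      apply Finset.single_le_sum (f := fun i => f i * f i * θ i) _ hi
      intro k hk
      rw [Finset.mem_Icc] at hk
      exact mul_nonneg (mul_self_nonneg _) (hpos k hk.1 hk.2).le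
    have h2 := hmono 1 i le_rfl hi'.1 hi'.2
    have h3 : f i * f i * θ 1 ≤ 1 :=
      le_trans (mul_le_mul_of_nonneg_left h2 (mul_self_nonneg _)) h1
    have h4 : f i * f i ≤ 1 / θ 1 := by rwa [le_div_iff₀ p1]
    have h5 : 0 < 1 / θ 1 := by positivity
    apply abs_le_of_sq_le_sq _ Bpos.le
    rw [hB]; nlinarith
  set c := ∑ i ∈ Finset.Icc 1 n, g i * θ i with hc
  set G : ℕ → ℝ := fun i => g i - c with hG
  have hG0 : ∑ i ∈ Finset.Icc 1 n, G i * θ i = 0 := by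
    simp only [hG, sub_mul, Finset.sum_sub_distrib, ← Finset.mul_sum, hsum]
    rw [← hc]; ring
  have hT : xT n θ Q (fun i => G i) = fun i : Finset.Icc 1 n => f i := by
    funext i
    have hi := Finset.mem_Icc.1 i.2
    rw [xT_apply, hG0, ← hfg i hi.1 hi.2]
    simp only [hG, mul_sub, Finset.sum_sub_distrib, ← Finset.sum_mul, hrow i hi.1 hi.2]
    ring
  have hb : ‖(fun i : Finset.Icc 1 n => G i)‖ ≤ K * B := by
    have h1 := hK.le_mul_dist (fun i : Finset.Icc 1 n => G i) 0
    rw [map_zero, hT, dist_zero_right, dist_zero_right] at h1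
    refine h1.trans (mul_le_mul_of_nonneg_left ?_ K.2)
    rw [pi_norm_le_iff_of_nonneg Bpos.le]
    intro i
    exact hfB i i.2
  have hGB : ∀ i ∈ Finset.Icc 1 n, |G i| ≤ K * B := by
    intro i hi
    exact (norm_le_pi_norm (fun i : Finset.Icc 1 n => G i) ⟨i, hi⟩).trans hb
  have h1 : ∑ i ∈ Finset.Icc 1 n, g i * f i * θ i = ∑ i ∈ Finset.Icc 1 n, G i * f i * θ i := by
    have : ∑ i ∈ Finset.Icc 1 n, G i * f i * θ i = ∑ i ∈ Finset.Icc 1 n, g i * f i * θ i -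
        c * ∑ i ∈ Finset.Icc 1 n, f i * θ i := by
      rw [Finset.mul_sum, ← Finset.sum_sub_distrib]
      exact Finset.sum_congr rfl fun _ _ => by simp only [hG]; ring
    rw [this, hf0]; ring
  have h2 : ∑ i ∈ Finset.Icc 1 n, G i * f i * θ i ≤ ∑ i ∈ Finset.Icc 1 n, K * B * B * θ i := by
    apply Finset.sum_le_sum
    intro i hi
    have hi' := Finset.mem_Icc.1 hi
    apply mul_le_mul_of_nonneg_right _ (hpos i hi'.1 hi'.2).le
    refine (le_abs_self _).trans ?_
    rw [abs_mul]
    exact mul_le_mul (hGB i hi) (hfB i hi) (abs_nonneg _) (mul_nonneg K.2 Bpos.le)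
  rw [← Finset.mul_sum, hsum] at h2
  rw [h1]; linarith

/-- **The explicit irreversible matrix minimizes the worst-case asymptotic variance.**
Let `θ` be a probability vector on states `1, …, n` (`n ≥ 2`, positive, nondecreasing)
and `P = explicitP n θ`.
(i) For every `θ`-mean-zero `f` with `‖f‖_θ = 1` and every `g` with `(I − P) g = f`,
the asymptotic variance `ν(f, P) = 2⟨g, f⟩_θ − 1` equals `(θ n − θ 1)/(θ n + θ 1)`.
(ii) For every irreducible row-stochastic matrix `Q` with invariant distribution `θ`,
there are such `f`, `g` with `ν(f, Q) ≥ (θ n − θ 1)/(θ n + θ 1)`.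
(iii) Hence the infimum over all irreducible row-stochastic matrices with invariant
distribution `θ` of the worst-case asymptotic variance `sup_f ν(f, ·)` equals
`(θ n − θ 1)/(θ n + θ 1)` (and `P` attains it, by (i)). -/
theorem explicitP_minimizes_worst_case_asymptotic_variance
    (n : ℕ) (hn : 2 ≤ n) (θ : ℕ → ℝ)
    (hpos : ∀ i, 1 ≤ i → i ≤ n → 0 < θ i)
    (hmono : ∀ i j, 1 ≤ i → i ≤ j → j ≤ n → θ i ≤ θ j)
    (hsum : ∑ i ∈ Finset.Icc 1 n, θ i = 1) :
    (∀ f g : ℕ → ℝ,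
      (∑ i ∈ Finset.Icc 1 n, f i * θ i) = 0 →
      (∑ i ∈ Finset.Icc 1 n, f i * f i * θ i) = 1 →
      (∀ i, 1 ≤ i → i ≤ n →
        g i - ∑ j ∈ Finset.Icc 1 n, explicitP n θ i j * g j = f i) →
      2 * (∑ i ∈ Finset.Icc 1 n, g i * f i * θ i) - 1 = (θ n - θ 1) / (θ n + θ 1)) ∧
    (∀ Q : ℕ → ℕ → ℝ,
      (∀ i j, 1 ≤ i → i ≤ n → 1 ≤ j → j ≤ n → 0 ≤ Q i j) →
      (∀ i, 1 ≤ i → i ≤ n → ∑ j ∈ Finset.Icc 1 n, Q i j = 1) →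
      (∀ i j, 1 ≤ i → i ≤ n → 1 ≤ j → j ≤ n →
        ∃ m : ℕ, 1 ≤ m ∧ 0 < matPowIcc n Q m i j) →
      (∀ j, 1 ≤ j → j ≤ n → ∑ i ∈ Finset.Icc 1 n, θ i * Q i j = θ j) →
      ∃ f g : ℕ → ℝ,
        (∑ i ∈ Finset.Icc 1 n, f i * θ i) = 0 ∧
        (∑ i ∈ Finset.Icc 1 n, f i * f i * θ i) = 1 ∧
        (∀ i, 1 ≤ i → i ≤ n →
          g i - ∑ j ∈ Finset.Icc 1 n, Q i j * g j = f i) ∧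
        (θ n - θ 1) / (θ n + θ 1) ≤
          2 * (∑ i ∈ Finset.Icc 1 n, g i * f i * θ i) - 1) ∧
    (sInf {v : ℝ | ∃ Q : ℕ → ℕ → ℝ,
        (∀ i j, 1 ≤ i → i ≤ n → 1 ≤ j → j ≤ n → 0 ≤ Q i j) ∧
        (∀ i, 1 ≤ i → i ≤ n → ∑ j ∈ Finset.Icc 1 n, Q i j = 1) ∧
        (∀ i j, 1 ≤ i → i ≤ n → 1 ≤ j → j ≤ n →
          ∃ m : ℕ, 1 ≤ m ∧ 0 < matPowIcc n Q m i j) ∧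
        (∀ j, 1 ≤ j → j ≤ n → ∑ i ∈ Finset.Icc 1 n, θ i * Q i j = θ j) ∧
        v = sSup {w : ℝ | ∃ f g : ℕ → ℝ,
          (∑ i ∈ Finset.Icc 1 n, f i * θ i) = 0 ∧
          (∑ i ∈ Finset.Icc 1 n, f i * f i * θ i) = 1 ∧
          (∀ i, 1 ≤ i → i ≤ n →
            g i - ∑ j ∈ Finset.Icc 1 n, Q i j * g j = f i) ∧
          w = 2 * (∑ i ∈ Finset.Icc 1 n, g i * f i * θ i) - 1}} =
      (θ n - θ 1) / (θ n + θ 1)) := by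
  have hi : ∀ f g : ℕ → ℝ,
      (∑ i ∈ Finset.Icc 1 n, f i * θ i) = 0 →
      (∑ i ∈ Finset.Icc 1 n, f i * f i * θ i) = 1 →
      (∀ i, 1 ≤ i → i ≤ n →
        g i - ∑ j ∈ Finset.Icc 1 n, explicitP n θ i j * g j = f i) →
      2 * (∑ i ∈ Finset.Icc 1 n, g i * f i * θ i) - 1 = (θ n - θ 1) / (θ n + θ 1) := by
    intro f g _ h1 hfg
    obtain ⟨m, rfl⟩ : ∃ m, n = m + 1 := ⟨n - 1, by omega⟩
    have p1 := hpos 1 le_rfl (by omega)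
    have pn := hpos (m+1) (by omega) le_rfl
    rw [(xfacts m θ hpos f g hfg).2, h1]
    field_simp
    ring
  refine ⟨hi, xpartii n hn θ hpos hsum, ?_⟩
  apply le_antisymm
  · have hP : (∀ i j, 1 ≤ i → i ≤ n → 1 ≤ j → j ≤ n → 0 ≤ explicitP n θ i j) ∧
        (∀ i, 1 ≤ i → i ≤ n → ∑ j ∈ Finset.Icc 1 n, explicitP n θ i j = 1) ∧
        (∀ i j, 1 ≤ i → i ≤ n → 1 ≤ j → j ≤ n →
          ∃ m : ℕ, 1 ≤ m ∧ 0 < matPowIcc n (explicitP n θ) m i j) ∧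
        (∀ j, 1 ≤ j → j ≤ n → ∑ i ∈ Finset.Icc 1 n, θ i * explicitP n θ i j = θ j) := by
      obtain ⟨m, rfl⟩ : ∃ m, n = m + 1 := ⟨n - 1, by omega⟩
      exact ⟨xP_nonneg m θ hpos hmono, fun i _ _ => xP_row m θ i,
        xP_irred m (by omega) θ hpos hmono, xP_inv m θ hpos⟩
    obtain ⟨a1, a2, a3, a4⟩ := hP
    apply csInf_le
    · refine ⟨(θ n - θ 1) / (θ n + θ 1), ?_⟩
      rintro v ⟨Q, h1, h2, h3, h4, rfl⟩
      obtain ⟨f, g, b1, b2, b3, b4⟩ := xpartii n hn θ hpos hsum Q h1 h2 h3 h4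
      exact b4.trans (le_csSup (xbdd n hn θ hpos hmono hsum Q h1 h2 h3 h4) ⟨f, g, b1, b2, b3, rfl⟩)
    · refine ⟨explicitP n θ, a1, a2, a3, a4, ?_⟩
      obtain ⟨f, g, b1, b2, b3, b4⟩ := xpartii n hn θ hpos hsum _ a1 a2 a3 a4
      symm
      rw [← csSup_singleton ((θ n - θ 1) / (θ n + θ 1))]
      congr 1
      ext w
      constructor
      · rintro ⟨f, g, b1, b2, b3, rfl⟩
        exact hi f g b1 b2 b3
      · intro hw
        rw [Set.mem_singleton_iff] at hw
        exact ⟨f, g, b1, b2, b3, by rw [hw, hi f g b1 b2 b3]⟩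
  · apply le_csInf
    · obtain ⟨m, rfl⟩ : ∃ m, n = m + 1 := ⟨n - 1, by omega⟩
      exact ⟨_, explicitP (m+1) θ, xP_nonneg m θ hpos hmono, fun i _ _ => xP_row m θ i,
        xP_irred m (by omega) θ hpos hmono, xP_inv m θ hpos, rfl⟩
    · rintro v ⟨Q, h1, h2, h3, h4, rfl⟩
      obtain ⟨f, g, b1, b2, b3, b4⟩ := xpartii n hn θ hpos hsum Q h1 h2 h3 h4
      exact b4.trans (le_csSup (xbdd n hn θ hpos hmono hsum Q h1 h2 h3 h4) ⟨f, g, b1, b2, b3, rfl⟩)
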